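/- Let F = ℚ(x, y) be the rational function field in two variables. There exist n ∈ ℕ, rational numbers ν_1, …, ν_n, and nonconstant rational functions g_1, …, g_n ∈ ℚ(x, y) such that S^⧢ I_{3,1}(x, y) − S^⧢ Ĩ_{3,1}(x, y) = Σ_{j=1}^n ν_j · S^⧢ Li_4(g_j) in V_F^{⊗4}. -/

import Mathlib

open scoped TensorProduct
open PiTensorProduct

attribute [local instance] Classical.propDecidable

set_option maxHeartbeats 1000000
set_option synthInstance.maxHeartbeats 400000

noncomputable section

namespace GrassPoly

variable (F : Type) [Field F]

/-- `V_F = F^× ⊗_ℤ ℚ` as a `ℚ`-vector space. -/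
abbrev VF : Type := ℚ ⊗[ℤ] (Additive Fˣ)

variable {F}

/-- The class `[a]` of a nonzero field element in `V_F` (defined to be `0` for `a = 0`). -/
def cls (a : F) : VF F :=
  if h : a = 0 then 0 else (1 : ℚ) ⊗ₜ[ℤ] (Additive.ofMul (Units.mk0 a h))

variable (F) in
/-- Tensor powers of V_F over ℚ. -/
abbrev TP (n : ℕ) : Type := ⨂[ℚ]^n (VF F)

instance instTPAddCommGroup (n : ℕ) : AddCommGroup (TP F n) :=
  Module.addCommMonoidToAddCommGroup ℚ

/-- Appending one extra tensor factor on the right. -/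
def snoc {n : ℕ} : TP F n →ₗ[ℚ] VF F →ₗ[ℚ] TP F (n + 1) :=
  PiTensorProduct.lift
    ((PiTensorProduct.tprod ℚ (s := fun _ : Fin (n + 1) => VF F)).curryRight)

/-- The factor `t_i` appearing in the recursive definition of the symbol,
as a function of `(a_{i-1}, a_i, a_{i+1})`. -/
def tCoef (p a q : F) : VF F :=
  if p = a then (if a = q then 0 else cls (q - a))
  else if a = q then - cls (p - a)
  else cls ((q - a) / (p - a))

/-- The symbol `S I(a₀; a₁, …, a_m; a_{m+1})`, with the middle entries given as a list
(of length `n`). -/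
def SIaux : (n : ℕ) → (a0 : F) → (as : List F) → (b : F) → as.length = n → TP F n
  | 0, _, _, _, _ => tprod ℚ (fun i : Fin 0 => i.elim0)
  | n + 1, a0, as, b, h =>
      ∑ i : Fin (n + 1),
        snoc (SIaux n a0 (as.eraseIdx i.val) b
            (by
              have hi' := i.isLt
              have hi : i.val < as.length := by omega
              have h2 := List.length_eraseIdx_of_lt hi
              omega))
          (tCoef ((a0 :: as).getD i.val 0) (as.getD i.val 0) ((as ++ [b]).getD (i.val + 1) 0))

/-- Cyclic rotation `b₁ ⊗ … ⊗ b_N ↦ b₂ ⊗ … ⊗ b_N ⊗ b₁` on tensor powers. -/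
def rotN (n : ℕ) : TP F n ≃ₗ[ℚ] TP F n :=
  PiTensorProduct.reindex ℚ (fun _ : Fin n => VF F) (finRotate n).symm

/-- Splitting off the last tensor factor. -/
def splitLast (n : ℕ) : TP F (n + 1) ≃ₗ[ℚ] (TP F n) ⊗[ℚ] (VF F) :=
  ((PiTensorProduct.reindex ℚ (fun _ : Fin (n + 1) => VF F)
      (finSumFinEquiv (m := n) (n := 1)).symm).trans
    (PiTensorProduct.tmulEquiv ℚ (VF F)).symm).trans
    (TensorProduct.congr (LinearEquiv.refl ℚ _)
      (PiTensorProduct.subsingletonEquiv (0 : Fin 1)))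

/-- The projector `Π̃_N` annihilating symbols of products. -/
def Pit : (n : ℕ) → TP F n →ₗ[ℚ] TP F n
  | 0 => LinearMap.id
  | 1 => LinearMap.id
  | (n + 2) =>
      ((splitLast (n + 1)).symm.toLinearMap
        ∘ₗ TensorProduct.map (Pit (n + 1)) LinearMap.id
        ∘ₗ (splitLast (n + 1)).toLinearMap)
      ∘ₗ ((LinearMap.id : TP F (n + 2) →ₗ[ℚ] TP F (n + 2)) - (rotN (F := F) (n + 2)).toLinearMap)

/-- The map on `V_F` induced by a field automorphism. -/
def vmap (φ : F ≃+* F) : VF F →ₗ[ℚ] VF F :=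
  TensorProduct.AlgebraTensorModule.map (LinearMap.id : ℚ →ₗ[ℚ] ℚ)
    (AddMonoidHom.toIntLinearMap
      { toFun := fun a => Additive.ofMul ((Units.map (φ : F →* F)) a.toMul)
        map_zero' := by simp
        map_add' := by intro a b; simp [_root_.map_mul] })

/-- The induced map on tensor powers. -/
def tpMap {n : ℕ} (φ : F ≃+* F) : TP F n →ₗ[ℚ] TP F n :=
  PiTensorProduct.map (fun _ => vmap φ)


/-! ### Symbols of (multiple) polylogarithms -/

/-- Symbol of `Li₂`. -/
def SLi2 (x : F) : TP F 2 := - SIaux 2 0 [x⁻¹, 0] 1 rfl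

/-- Symbol of `Li₃`. -/
def SLi3 (x : F) : TP F 3 := - SIaux 3 0 [x⁻¹, 0, 0] 1 rfl

/-- Symbol of `Li₄`. -/
def SLi4 (x : F) : TP F 4 := - SIaux 4 0 [x⁻¹, 0, 0, 0] 1 rfl

/-- Symbol of `Li₅`. -/
def SLi5 (x : F) : TP F 5 := - SIaux 5 0 [x⁻¹, 0, 0, 0, 0] 1 rfl

/-- Symbol of `I_{3,1}(x,y) = I(0; x,0,0,y; 1)`. -/
def SI31 (x y : F) : TP F 4 := SIaux 4 0 [x, 0, 0, y] 1 rfl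

/-- Symbol of `I_{4,1}(x,y) = I(0; x,0,0,0,y; 1)`. -/
def SI41 (x y : F) : TP F 5 := SIaux 5 0 [x, 0, 0, 0, y] 1 rfl

/-- Symbol of `I⁺_{4,1}(x,y) = ½ (I_{4,1}(x,y) + I_{4,1}(x,y⁻¹))`. -/
def I41p (x y : F) : TP F 5 := (2 : ℚ)⁻¹ • (SI41 x y + SI41 x y⁻¹)

/-- The anharmonic orbit of `x`, together with the signs of the
corresponding permutations in `S₃`. -/
def anhList (x : F) : List (ℚ × F) :=
  [(1, x), (1, (1 - x)⁻¹), (1, 1 - x⁻¹), (-1, x⁻¹), (-1, 1 - x), (-1, x / (x - 1))]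

/-- Symbol of `Ĩ_{3,1}(x,y) = (1/36) Σ_{σ,π ∈ S₃} sgn(σ) sgn(π) I_{3,1}(x^σ, y^π)`. -/
def tI31 (x y : F) : TP F 4 :=
  (36 : ℚ)⁻¹ •
    ((anhList x).map (fun p =>
      ((anhList y).map (fun q => (p.1 * q.1) • SI31 p.2 q.2)).sum)).sum

/-- Symbol of `Ĩ⁺_{4,1}(x,y) = (1/6) Σ_{σ ∈ S₃} sgn(σ) I⁺_{4,1}(x^σ, y)`. -/
def tI41p (x y : F) : TP F 5 :=
  (6 : ℚ)⁻¹ • ((anhList x).map (fun p => p.1 • I41p p.2 y)).sum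

/-- Symbol of `V(z; x, y) = Ĩ_{3,1}(z, [x]+[y]+[(1-x)/(1-xy)]+[1-xy]+[(1-y)/(1-xy)])`. -/
def Vc (z x y : F) : TP F 4 :=
  tI31 z x + tI31 z y + tI31 z ((1 - x) / (1 - x * y)) + tI31 z (1 - x * y)
    + tI31 z ((1 - y) / (1 - x * y))

/-- `Sym₃₆(a,b) := I_{3,1}(a,b) - Ĩ_{3,1}(a,b)` (on the level of symbols). -/
def S36 (a b : F) : TP F 4 := SI31 a b - tI31 a b

/-! ### Generic vectors -/

variable (N m : ℕ)

/-- Polynomial ring on the entries of `N` generic vectors in `m`-space. -/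
abbrev Pol : Type := MvPolynomial (Fin N × Fin m) ℚ

/-- The field of rational functions in the entries of `N` generic vectors in `m`-space. -/
abbrev FF : Type := FractionRing (Pol N m)

/-- The `j`-th coordinate of the `i`-th generic vector. -/
def gen (i : Fin N) (j : Fin m) : FF N m :=
  algebraMap (Pol N m) (FF N m) (MvPolynomial.X (i, j))

/-- `⟨i₁ … i_m⟩`: the determinant of the matrix whose columns are
the generic vectors selected by `cols`. -/
def dets (cols : Fin m → Fin N) : FF N m :=
  (Matrix.of fun r c => gen N m (cols c) r).det

/-- The field automorphism of `FF N m` induced by a permutation of the `N` vectors. -/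
def permAut (σ : Equiv.Perm (Fin N)) : FF N m ≃+* FF N m :=
  IsFractionRing.ringEquivOfRingEquiv
    ((MvPolynomial.renameEquiv ℚ (σ.prodCongr (Equiv.refl (Fin m)))).toRingEquiv)

variable {N m}

/-- Skew-symmetrization over all permutations of the `N` generic vectors. -/
def Alt {n : ℕ} (x : TP (FF N m) n) : TP (FF N m) n :=
  ∑ σ : Equiv.Perm (Fin N), (((Equiv.Perm.sign σ : ℤˣ) : ℤ) : ℚ) • tpMap (permAut N m σ) x

end GrassPoly

end

namespace GrassPoly

noncomputable section TwoVar

/-- The rational function field `ℚ(x, y)`. -/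
abbrev K2 : Type := FractionRing (MvPolynomial (Fin 2) ℚ)

/-- The variable `x`. -/
def xx : K2 := algebraMap (MvPolynomial (Fin 2) ℚ) K2 (MvPolynomial.X 0)

/-- The variable `y`. -/
def yy : K2 := algebraMap (MvPolynomial (Fin 2) ℚ) K2 (MvPolynomial.X 1)

end TwoVar

end GrassPoly

namespace GrassPoly

section QuadrilinearForms

variable {V M : Type*} [AddCommGroup V] [Module ℚ V] [AddCommGroup M] [Module ℚ M]
  (f : V →ₗ[ℚ] V →ₗ[ℚ] V →ₗ[ℚ] V →ₗ[ℚ] M)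

/-- The mod-products projection of the word `a ⊗ b ⊗ c ⊗ d`, written through a map `f` standing
for `(a ∧ b) ⊗ c ⊗ d`. -/
def projWord (a b c d : V) : M :=
  f a b c d - f b c a d - f b c d a + f c d b a

/-- The mod-products symbol of `I_{3,1}(x, y)` in terms of the classes `X, Y, A, B, D` of
`x, y, 1 - x, 1 - y, x - y`. -/
def i31Form (X Y A B D : V) : M :=
  projWord f (B - Y) (D - X) (Y - X) (Y - X) + projWord f (A - X) (B - D) (Y - X) (Y - X)
    - projWord f (A - X) X (B - Y) (Y - X) + projWord f (A - X) X X (B - Y)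

/-- The mod-products symbol of `Li₄(g)` in terms of the classes `u, v` of `1 - g, g`. -/
def li4Form (u v : V) : M := f v u v v

variable {f}

theorem i31Form_add_i31Form_swap (hf : ∀ a b, f a b = - f b a) (hf0 : ∀ a, f a a = 0)
    (X Y A B D : V) : i31Form f X Y A B D + i31Form f Y X B A D = 0 := by
  simp only [i31Form, projWord, map_sub, LinearMap.sub_apply, hf0,
    LinearMap.zero_apply, LinearMap.neg_apply,
    hf Y X, hf A X, hf B X, hf D X, hf A Y, hf B Y, hf D Y, hf B A]
  abel

theorem i31Form_sub_i31Form_inv (hf : ∀ a b, f a b = - f b a) (hf0 : ∀ a, f a a = 0)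
    (X Y A B D : V) :
    i31Form f X Y A B D - i31Form f (-X) (-Y) (A - X) (B - Y) (D - X - Y) =
      - li4Form f B Y + li4Form f A X + 3 • li4Form f (D - Y) (X - Y) := by
  simp only [i31Form, projWord, li4Form, map_sub, map_neg,
    LinearMap.sub_apply, hf0, LinearMap.zero_apply, LinearMap.neg_apply,
    hf Y X, hf A X, hf B X, hf D X, hf A Y, hf B Y, hf D Y]
  abel

theorem i31Form_sub_i31Form_one_sub (hf : ∀ a b, f a b = - f b a) (hf0 : ∀ a, f a a = 0)
    (X Y A B D : V) :
    i31Form f X Y A B D - i31Form f A B X Y D =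
      - 2 • li4Form f (D - B) (A - B) + 2 • li4Form f (D - Y) (X - Y)
        + li4Form f (D - Y - A) (X - Y - A + B) + li4Form f (-B) (Y - B)
        - li4Form f (-A) (X - A) := by
  simp only [i31Form, projWord, li4Form, map_add, map_sub, map_neg, LinearMap.add_apply,
    LinearMap.sub_apply, hf0, LinearMap.zero_apply, LinearMap.neg_apply,
    hf Y X, hf A X, hf B X, hf D X, hf A Y, hf B Y, hf D Y, hf B A, hf D A, hf D B]
  abel

theorem i31Form_add_i31Form_one_sub_left (hf : ∀ a b, f a b = - f b a) (hf0 : ∀ a, f a a = 0)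
    (X Y A B D E : V) :
    2 • (i31Form f X Y A B D + i31Form f A Y X B E) =
      6 • li4Form f (D - Y) (X - Y) - 6 • li4Form f (E - A) (Y - A)
        + li4Form f (D - Y - A) (X - Y - A + B) - li4Form f (D + E - Y - B) (X + A - Y - B)
        - li4Form f (E - A - B) (X + Y - A - B) + 2 • li4Form f (-B) (Y - B)
        + 2 • li4Form f (D - B) (A - B) + 2 • li4Form f (E - B) (X - B) := by
  simp only [i31Form, projWord, li4Form, map_add, map_sub, map_neg, LinearMap.add_apply,
    LinearMap.sub_apply, hf0, LinearMap.zero_apply, LinearMap.neg_apply,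
    hf Y X, hf A X, hf B X, hf D X, hf A Y, hf B Y, hf D Y, hf E Y, hf B A, hf E A]
  abel

end QuadrilinearForms

section Symbols

variable {F : Type} [Field F]

theorem cls_one : cls (1 : F) = 0 := by
  have h : Units.mk0 (1 : F) one_ne_zero = 1 := by ext; rfl
  simp [cls, h]

theorem cls_mul {a b : F} (ha : a ≠ 0) (hb : b ≠ 0) : cls (a * b) = cls a + cls b := by
  simp [cls, ha, hb, Units.mk0_mul, TensorProduct.tmul_add]

theorem cls_neg (a : F) : cls (-a) = cls a := by
  by_cases ha : a = 0
  · simp [ha]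
  · have h1 : cls (-1 : F) = 0 := by
      have h := cls_mul (F := F) (a := -1) (b := -1) (by simp) (by simp)
      rw [neg_one_mul, neg_neg, cls_one, ← two_smul ℚ] at h
      simpa using h.symm
    rw [← neg_one_mul, cls_mul (by simp) ha, h1, zero_add]

theorem cls_sub_comm (a b : F) : cls (a - b) = cls (b - a) := by
  rw [← cls_neg, neg_sub]

theorem cls_inv (a : F) : cls a⁻¹ = - cls a := by
  by_cases ha : a = 0
  · simp [ha, cls]
  · rw [eq_neg_iff_add_eq_zero, ← cls_mul (inv_ne_zero ha) ha, inv_mul_cancel₀ ha, cls_one]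

theorem cls_div {a b : F} (ha : a ≠ 0) (hb : b ≠ 0) : cls (a / b) = cls a - cls b := by
  rw [div_eq_mul_inv, cls_mul ha (inv_ne_zero hb), cls_inv, sub_eq_add_neg]

theorem snoc_tprod {n : ℕ} (g : Fin n → VF F) (v : VF F) :
    snoc (tprod ℚ g) v = tprod ℚ (Fin.snoc g v : Fin (n + 1) → VF F) := by
  simp [snoc]

theorem splitLast_tprod (n : ℕ) (g : Fin (n + 1) → VF F) :
    splitLast n (tprod ℚ g) = tprod ℚ (fun i => g i.castSucc) ⊗ₜ[ℚ] g (Fin.last n) := by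
  simp only [splitLast, LinearEquiv.trans_apply, reindex_tprod, tmulEquiv_symm_apply,
    TensorProduct.congr_tmul, LinearEquiv.refl_apply]
  congr 1
  exact subsingletonEquiv_apply_tprod _ _

theorem splitLast_symm_tmul (n : ℕ) (t : TP F n) (v : VF F) :
    (splitLast n).symm (t ⊗ₜ[ℚ] v) = snoc t v := by
  have h : (TensorProduct.mk ℚ (TP F n) (VF F)).compr₂ (splitLast n).symm.toLinearMap = snoc := by
    ext g w
    simp [LinearEquiv.symm_apply_eq, snoc_tprod, splitLast_tprod]
  exact LinearMap.congr_fun₂ h t v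

theorem Pit_tprod (n : ℕ) (g : Fin (n + 2) → VF F) :
    Pit (n + 2) (tprod ℚ g) =
      snoc (Pit (n + 1) (tprod ℚ fun i => g i.castSucc)) (g (Fin.last (n + 1)))
        - snoc (Pit (n + 1) (tprod ℚ fun i => g i.succ)) (g 0) := by
  simp [Pit, rotN, reindex_tprod, splitLast_tprod, splitLast_symm_tmul]

/-- The tensor `a ⊗ b ⊗ c ⊗ d`. -/
def word (a b c d : VF F) : TP F 4 :=
  snoc (snoc (snoc (snoc (tprod ℚ fun i : Fin 0 => i.elim0) a) b) c) d

variable (F) in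
/-- The quadrilinear map `(a ⊗ b - b ⊗ a) ⊗ c ⊗ d`. -/
def wedgeWord : VF F →ₗ[ℚ] VF F →ₗ[ℚ] VF F →ₗ[ℚ] VF F →ₗ[ℚ] TP F 4 :=
  let t : VF F →ₗ[ℚ] VF F →ₗ[ℚ] TP F 2 := snoc ∘ₗ snoc (tprod ℚ fun i : Fin 0 => i.elim0)
  (t - t.flip).compr₂ (snoc.compr₂ snoc)

theorem wedgeWord_apply (a b c d : VF F) :
    wedgeWord F a b c d = word a b c d - word b a c d := by
  simp [wedgeWord, word]

theorem wedgeWord_swap (a b : VF F) : wedgeWord F a b = - wedgeWord F b a := by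
  ext c d
  simp [wedgeWord_apply]

theorem wedgeWord_self (a : VF F) : wedgeWord F a a = 0 := by
  ext c d
  simp [wedgeWord_apply]

theorem Pit_word (a b c d : VF F) : Pit 4 (word a b c d) = projWord (wedgeWord F) a b c d := by
  have h (v : VF F) : (Fin.snoc (fun i : Fin 0 => i.elim0) v : Fin 1 → VF F) = fun _ => v := by
    funext i
    rw [show i = Fin.last 0 from Fin.fin_one_eq_zero i, Fin.snoc_last]
  simp only [projWord, wedgeWord_apply, word, snoc_tprod, Pit_tprod, h]
  simp [Pit, snoc_tprod, Fin.snoc]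
  abel

theorem Pit_SLi4 {g : F} (h0 : g ≠ 0) (h1 : g ≠ 1) :
    Pit 4 (SLi4 g) = li4Form (wedgeWord F) (cls (1 - g)) (cls g) := by
  have hg : cls ((1 - g⁻¹) / -g⁻¹) = cls (1 - g) := by
    congr 1
    field_simp
    ring
  have h : SLi4 g = - word (cls (1 - g)) (cls g) (cls g) (cls g) := by
    simp [SLi4, SIaux, Fin.sum_univ_succ, tCoef, h0, h1, h0.symm, cls_one, cls_inv, hg, word]
  rw [h, map_neg, Pit_word]
  simp [projWord, li4Form, wedgeWord_self, wedgeWord_swap (cls (1 - g))]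

theorem SI31_eq_word {x y : F} (hx0 : x ≠ 0) (hx1 : x ≠ 1) (hy0 : y ≠ 0) (hy1 : y ≠ 1)
    (hxy : x ≠ y) :
    SI31 x y =
      word (cls (1 - y) - cls y) (cls (x - y) - cls x) (cls y - cls x) (cls y - cls x)
        + word (cls (1 - x) - cls x) (cls (1 - y) - cls (x - y)) (cls y - cls x) (cls y - cls x)
        - word (cls (1 - x) - cls x) (cls x) (cls (1 - y) - cls y) (cls y - cls x)
        + word (cls (1 - x) - cls x) (cls x) (cls x) (cls (1 - y) - cls y) := by
  have hX : cls ((1 - x) / -x) = cls (1 - x) - cls x := by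
    rw [cls_div (sub_ne_zero.2 hx1.symm) (neg_ne_zero.2 hx0), cls_neg]
  have hY : cls ((1 - y) / -y) = cls (1 - y) - cls y := by
    rw [cls_div (sub_ne_zero.2 hy1.symm) (neg_ne_zero.2 hy0), cls_neg]
  have hXY : cls ((y - x) / -x) = cls (x - y) - cls x := by
    rw [cls_div (sub_ne_zero.2 hxy.symm) (neg_ne_zero.2 hx0), cls_neg, cls_sub_comm]
  simp only [SI31, SIaux, Fin.sum_univ_succ]
  simp [tCoef, hx0, hx1, hy1, hxy, hx0.symm, hy0.symm, word, hX, hY, hXY, cls_one, cls_inv,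
    cls_div hy0 hx0, cls_div (sub_ne_zero.2 hy1.symm) (sub_ne_zero.2 hxy)]
  abel

theorem Pit_SI31 {x y : F} (hx0 : x ≠ 0) (hx1 : x ≠ 1) (hy0 : y ≠ 0) (hy1 : y ≠ 1)
    (hxy : x ≠ y) :
    Pit 4 (SI31 x y) =
      i31Form (wedgeWord F) (cls x) (cls y) (cls (1 - x)) (cls (1 - y)) (cls (x - y)) := by
  simp only [SI31_eq_word hx0 hx1 hy0 hy1 hxy, map_add, map_sub, Pit_word, i31Form]

end Symbols

section GenericPairs

variable {K : Type} [Field K] [CharZero K] {a b : K}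

/-- A pair of algebraically independent elements over `ℚ`. -/
def GenericPair (a b : K) : Prop := AlgebraicIndependent ℚ ![a, b]

theorem genericPair_iff :
    GenericPair a b ↔
      AlgebraicIndependent ℚ (fun _ : Unit => b) ∧
        Transcendental (Algebra.adjoin ℚ {b}) a := by
  have h := AlgebraicIndependent.option_iff (R := ℚ) (x := fun _ : Unit => b) (a := a)
  rw [Set.range_const] at h
  rw [← h, GenericPair]
  let e : Option Unit ≃ Fin 2 :=
    { toFun := fun o => o.elim 0 fun _ => 1
      invFun := ![none, some ()]
      left_inv := by rintro (_ | _) <;> rfl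
      right_inv := by intro i; fin_cases i <;> rfl }
  refine (algebraicIndependent_equiv' e ?_).symm
  funext o
  cases o <;> rfl

namespace GenericPair

theorem swap (h : GenericPair a b) : GenericPair b a := by
  have h' := AlgebraicIndependent.comp h _ (Equiv.swap (0 : Fin 2) 1).injective
  have e : ![a, b] ∘ Equiv.swap (0 : Fin 2) 1 = ![b, a] := by
    funext i
    fin_cases i <;> rfl
  rwa [e] at h'

theorem inv_left (h : GenericPair a b) : GenericPair a⁻¹ b := by
  rw [genericPair_iff] at h ⊢
  exact ⟨h.1, fun h' => h.2 (IsAlgebraic.inv_iff.1 h')⟩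

theorem one_sub_left (h : GenericPair a b) : GenericPair (1 - a) b := by
  rw [genericPair_iff] at h ⊢
  refine ⟨h.1, fun h' => h.2 ?_⟩
  simpa using isAlgebraic_one.sub h'

theorem inv_right (h : GenericPair a b) : GenericPair a b⁻¹ := h.swap.inv_left.swap

theorem one_sub_right (h : GenericPair a b) : GenericPair a (1 - b) := h.swap.one_sub_left.swap

theorem aeval_ne_zero (h : GenericPair a b) (p : MvPolynomial (Fin 2) ℚ) (v : Fin 2 → ℚ)
    (hv : MvPolynomial.eval v p ≠ 0) : MvPolynomial.aeval ![a, b] p ≠ 0 := by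
  intro h0
  rw [(injective_iff_map_eq_zero _).1 h p h0] at hv
  exact hv (map_zero _)

theorem aeval_div_notMem_range (h : GenericPair a b) (p q : MvPolynomial (Fin 2) ℚ)
    (u v : Fin 2 → ℚ)
    (huv : MvPolynomial.eval u p * MvPolynomial.eval v q ≠
      MvPolynomial.eval v p * MvPolynomial.eval u q) :
    MvPolynomial.aeval ![a, b] p / MvPolynomial.aeval ![a, b] q ∉
      Set.range (algebraMap ℚ K) := by
  rintro ⟨c, hc⟩
  by_cases hq : MvPolynomial.aeval ![a, b] q = 0
  · rw [(injective_iff_map_eq_zero _).1 h q hq] at huv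
    simp at huv
  · rw [eq_div_iff hq] at hc
    have hp : p = MvPolynomial.C c * q := h (by simp [← hc])
    apply huv
    rw [hp]
    simp only [map_mul, MvPolynomial.eval_C]
    ring

open MvPolynomial in
theorem ne_zero (h : GenericPair a b) : a ≠ 0 := by
  simpa using h.aeval_ne_zero (X 0) ![2, 5] (by simp)

open MvPolynomial in
theorem ne_one (h : GenericPair a b) : a ≠ 1 := by
  have key := h.aeval_ne_zero (X 0 - 1) ![2, 5] (by norm_num)
  simp only [map_sub, map_one, aeval_X] at key
  exact sub_ne_zero.1 key

open MvPolynomial in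
theorem ne (h : GenericPair a b) : a ≠ b := by
  have key := h.aeval_ne_zero (X 0 - X 1) ![2, 5] (by norm_num)
  simp only [map_sub, aeval_X] at key
  exact sub_ne_zero.1 key

open MvPolynomial in
theorem left_notMem_range (h : GenericPair a b) : a ∉ Set.range (algebraMap ℚ K) := by
  simpa using h.aeval_div_notMem_range (X 0) 1 ![2, 5] ![3, 5] (by norm_num)

open MvPolynomial in
theorem div_notMem_range (h : GenericPair a b) : a / b ∉ Set.range (algebraMap ℚ K) := by
  simpa using h.aeval_div_notMem_range (X 0) (X 1) ![2, 5] ![3, 5] (by norm_num)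

open MvPolynomial in
theorem mul_one_sub_div_notMem_range (h : GenericPair a b) :
    a * (1 - b) / (b * (1 - a)) ∉ Set.range (algebraMap ℚ K) := by
  have key := h.aeval_div_notMem_range (X 0 * (1 - X 1)) (X 1 * (1 - X 0)) ![2, 5] ![3, 5]
    (by norm_num)
  simp only [map_mul, map_sub, map_one, aeval_X] at key
  exact key

open MvPolynomial in
theorem mul_div_notMem_range (h : GenericPair a b) :
    a * (1 - a) / (b * (1 - b)) ∉ Set.range (algebraMap ℚ K) := by
  have key := h.aeval_div_notMem_range (X 0 * (1 - X 0)) (X 1 * (1 - X 1)) ![2, 5] ![3, 5]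
    (by norm_num)
  simp only [map_mul, map_sub, map_one, aeval_X] at key
  exact key

open MvPolynomial in
theorem neg_div_one_sub_notMem_range (h : GenericPair a b) :
    -a / (1 - a) ∉ Set.range (algebraMap ℚ K) := by
  have key := h.aeval_div_notMem_range (-X 0) (1 - X 0) ![2, 5] ![3, 5] (by norm_num)
  simp only [map_neg, map_sub, map_one, aeval_X] at key
  exact key

end GenericPair

theorem genericPair_xx_yy : GenericPair xx yy := by
  have h := (MvPolynomial.algebraicIndependent_X (Fin 2) ℚ).map'
    (f := IsScalarTower.toAlgHom ℚ (MvPolynomial (Fin 2) ℚ) K2)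
    (IsFractionRing.injective (MvPolynomial (Fin 2) ℚ) K2)
  have e : ![xx, yy] = IsScalarTower.toAlgHom ℚ (MvPolynomial (Fin 2) ℚ) K2 ∘
      MvPolynomial.X := by
    funext i
    fin_cases i <;> rfl
  rw [GenericPair, e]
  exact h

end GenericPairs

section Reduction

/-- The span of the mod-products symbols of `Li₄` at nonconstant rational functions. -/
noncomputable def li4Span : Submodule ℚ (TP K2 4) :=
  Submodule.span ℚ ((fun g => Pit 4 (SLi4 g)) '' {g | g ∉ Set.range (algebraMap ℚ K2)})

/-- The class of the mod-products symbol of `I_{3,1}(a, b)` modulo the span of `Li₄` symbols. -/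
noncomputable def i31Class (a b : K2) : TP K2 4 ⧸ li4Span := li4Span.mkQ (Pit 4 (SI31 a b))

theorem mkQ_li4Form {g : K2} {u v : VF K2} (hg : g ∉ Set.range (algebraMap ℚ K2))
    (hu : cls (1 - g) = u) (hv : cls g = v) :
    li4Span.mkQ (li4Form (wedgeWord K2) u v) = 0 := by
  have h0 : g ≠ 0 := by
    rintro rfl
    exact hg ⟨0, map_zero _⟩
  have h1 : g ≠ 1 := by
    rintro rfl
    exact hg ⟨1, map_one _⟩
  rw [← hu, ← hv, ← Pit_SLi4 h0 h1, Submodule.mkQ_apply, Submodule.Quotient.mk_eq_zero]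
  exact Submodule.subset_span ⟨g, hg, rfl⟩

namespace GenericPair

variable {a b : K2}

theorem Pit_SI31 (h : GenericPair a b) :
    Pit 4 (SI31 a b) =
      i31Form (wedgeWord K2) (cls a) (cls b) (cls (1 - a)) (cls (1 - b)) (cls (a - b)) :=
  GrassPoly.Pit_SI31 h.ne_zero h.ne_one h.swap.ne_zero h.swap.ne_one h.ne

theorem mkQ_li4Form_left (h : GenericPair a b) :
    li4Span.mkQ (li4Form (wedgeWord K2) (cls (1 - a)) (cls a)) = 0 :=
  mkQ_li4Form h.left_notMem_range rfl rfl

theorem mkQ_li4Form_div (h : GenericPair a b) :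
    li4Span.mkQ (li4Form (wedgeWord K2) (cls (a - b) - cls b) (cls a - cls b)) = 0 := by
  have hb := h.swap.ne_zero
  refine mkQ_li4Form h.div_notMem_range ?_ (cls_div h.ne_zero hb)
  rw [cls_sub_comm a b, ← cls_div (sub_ne_zero.2 h.swap.ne) hb]
  congr 1
  field_simp

theorem mkQ_li4Form_neg_div_one_sub (h : GenericPair a b) :
    li4Span.mkQ (li4Form (wedgeWord K2) (-cls (1 - a)) (cls a - cls (1 - a))) = 0 := by
  have ha := h.one_sub_left.ne_zero
  refine mkQ_li4Form h.neg_div_one_sub_notMem_range ?_ ?_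
  · rw [← cls_inv]
    congr 1
    field_simp
    ring
  · rw [cls_div (neg_ne_zero.2 h.ne_zero) ha, cls_neg]

theorem mkQ_li4Form_mul_one_sub_div (h : GenericPair a b) :
    li4Span.mkQ (li4Form (wedgeWord K2) (cls (a - b) - cls b - cls (1 - a))
      (cls a - cls b - cls (1 - a) + cls (1 - b))) = 0 := by
  have hb := h.swap.ne_zero
  have ha1 := h.one_sub_left.ne_zero
  have hb1 := h.swap.one_sub_left.ne_zero
  refine mkQ_li4Form h.mul_one_sub_div_notMem_range ?_ ?_
  · rw [cls_sub_comm a b, sub_sub, ← cls_mul hb ha1,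
      ← cls_div (sub_ne_zero.2 h.swap.ne) (mul_ne_zero hb ha1)]
    congr 1
    field_simp
    ring
  · rw [cls_div (mul_ne_zero h.ne_zero hb1) (mul_ne_zero hb ha1), cls_mul h.ne_zero hb1,
      cls_mul hb ha1]
    abel

theorem mkQ_li4Form_mul_div (h : GenericPair a b) :
    li4Span.mkQ (li4Form (wedgeWord K2) (cls (a - b) + cls (1 - a - b) - cls b - cls (1 - b))
      (cls a + cls (1 - a) - cls b - cls (1 - b))) = 0 := by
  have hb := h.swap.ne_zero
  have ha1 := h.one_sub_left.ne_zero
  have hb1 := h.swap.one_sub_left.ne_zero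
  have hab := sub_ne_zero.2 h.swap.ne
  have hab1 := sub_ne_zero.2 h.one_sub_left.ne
  refine mkQ_li4Form h.mul_div_notMem_range ?_ ?_
  · rw [cls_sub_comm a b, sub_sub, ← cls_mul hab hab1, ← cls_mul hb hb1,
      ← cls_div (mul_ne_zero hab hab1) (mul_ne_zero hb hb1)]
    congr 1
    field_simp
    ring
  · rw [cls_div (mul_ne_zero h.ne_zero ha1) (mul_ne_zero hb hb1), cls_mul h.ne_zero ha1,
      cls_mul hb hb1]
    abel

theorem i31Class_swap (h : GenericPair a b) : i31Class b a = - i31Class a b := by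
  have key := i31Form_add_i31Form_swap (f := wedgeWord K2) wedgeWord_swap wedgeWord_self
    (cls a) (cls b) (cls (1 - a)) (cls (1 - b)) (cls (a - b))
  rw [← h.Pit_SI31, cls_sub_comm a b, ← h.swap.Pit_SI31] at key
  rw [eq_neg_iff_add_eq_zero, add_comm, i31Class, i31Class, ← map_add, key, map_zero]

theorem i31Class_inv (h : GenericPair a b) : i31Class a⁻¹ b⁻¹ = i31Class a b := by
  have h' := h.inv_left.inv_right
  have ha := h.ne_zero
  have hb := h.swap.ne_zero
  have hab := sub_ne_zero.2 h.swap.ne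
  have one_sub_inv {c : K2} (hc0 : c ≠ 0) (hc1 : 1 - c ≠ 0) :
      cls (1 - c⁻¹) = cls (1 - c) - cls c := by
    rw [← cls_div hc1 hc0, cls_sub_comm]
    congr 1
    field_simp
  have hsub : cls (a⁻¹ - b⁻¹) = cls (a - b) - cls a - cls b := by
    rw [cls_sub_comm a b, sub_sub, ← cls_mul ha hb, ← cls_div hab (mul_ne_zero ha hb)]
    congr 1
    field_simp
  have key := i31Form_sub_i31Form_inv (f := wedgeWord K2) wedgeWord_swap wedgeWord_self
    (cls a) (cls b) (cls (1 - a)) (cls (1 - b)) (cls (a - b))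
  rw [← h.Pit_SI31, ← one_sub_inv ha h.one_sub_left.ne_zero,
    ← one_sub_inv hb h.swap.one_sub_left.ne_zero, ← hsub, ← cls_inv, ← cls_inv,
    ← h'.Pit_SI31] at key
  rw [eq_comm, ← sub_eq_zero, i31Class, i31Class, ← map_sub, key]
  simp only [map_add, map_neg, map_nsmul, h.mkQ_li4Form_left, h.swap.mkQ_li4Form_left,
    h.mkQ_li4Form_div]
  abel

theorem i31Class_one_sub (h : GenericPair a b) :
    i31Class (1 - a) (1 - b) = i31Class a b := by
  have h' := h.one_sub_left.one_sub_right
  have key := i31Form_sub_i31Form_one_sub (f := wedgeWord K2) wedgeWord_swap wedgeWord_self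
    (cls a) (cls b) (cls (1 - a)) (cls (1 - b)) (cls (a - b))
  have hsub : cls (1 - a - (1 - b)) = cls (a - b) := by
    rw [sub_sub_sub_cancel_left, cls_sub_comm]
  have hdiv := h'.mkQ_li4Form_div
  have hP := h'.Pit_SI31
  rw [hsub] at hdiv
  rw [hsub, sub_sub_cancel, sub_sub_cancel] at hP
  rw [← h.Pit_SI31, ← hP] at key
  rw [eq_comm, ← sub_eq_zero, i31Class, i31Class, ← map_sub, key]
  simp only [map_add, map_sub, map_zsmul, map_nsmul, hdiv, h.mkQ_li4Form_div,
    h.mkQ_li4Form_mul_one_sub_div, h.mkQ_li4Form_neg_div_one_sub,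
    h.swap.mkQ_li4Form_neg_div_one_sub]
  abel

theorem i31Class_one_sub_left (h : GenericPair a b) : i31Class (1 - a) b = - i31Class a b := by
  have h' := h.one_sub_left
  have key := i31Form_add_i31Form_one_sub_left (f := wedgeWord K2) wedgeWord_swap wedgeWord_self
    (cls a) (cls b) (cls (1 - a)) (cls (1 - b)) (cls (a - b)) (cls (1 - a - b))
  have hP := h'.Pit_SI31
  rw [sub_sub_cancel] at hP
  rw [← h.Pit_SI31, ← hP] at key
  have hE : cls (a - (1 - b)) = cls (1 - a - b) := by
    rw [cls_sub_comm, sub_right_comm]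
  have d1 := h'.swap.mkQ_li4Form_div
  rw [cls_sub_comm b (1 - a)] at d1
  have d2 := h.one_sub_right.mkQ_li4Form_div
  rw [hE] at d2
  have d3 := h'.one_sub_right.mkQ_li4Form_div
  rw [sub_sub_sub_cancel_left, cls_sub_comm b a] at d3
  have d4 := h.one_sub_right.mkQ_li4Form_mul_one_sub_div
  rw [hE, sub_sub_cancel, sub_right_comm (cls (1 - a - b)),
    show cls a - cls (1 - b) - cls (1 - a) + cls b
      = cls a + cls b - cls (1 - a) - cls (1 - b) by abel] at d4
  replace key := congrArg li4Span.mkQ key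
  simp only [map_add, map_sub, map_nsmul, d1, d2, d3, d4, h.mkQ_li4Form_div,
    h.mkQ_li4Form_mul_one_sub_div, h.mkQ_li4Form_mul_div,
    h.swap.mkQ_li4Form_neg_div_one_sub] at key
  rw [eq_neg_iff_add_eq_zero, i31Class, i31Class]
  linear_combination (norm := module) (2⁻¹ : ℚ) • key

theorem i31Class_inv_left (h : GenericPair a b) : i31Class a⁻¹ b = - i31Class a b := by
  have ha := h.ne_zero
  have ha1 := h.one_sub_left.ne_zero
  have h1 := h.inv_left.inv_right.one_sub_left.one_sub_right
  have h2 := h.one_sub_left.inv_right.one_sub_right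
  have e : 1 - (1 - a⁻¹)⁻¹ = (1 - a)⁻¹ := by
    have : a - 1 ≠ 0 := sub_ne_zero.2 h.ne_one
    field_simp
    ring
  calc i31Class a⁻¹ b = i31Class (1 - a)⁻¹ (1 - b⁻¹)⁻¹ := by
        rw [← h.inv_left.i31Class_inv, inv_inv,
          ← h.inv_right.i31Class_one_sub, ← h2.i31Class_inv]
    _ = i31Class (1 - (1 - a⁻¹)⁻¹) (1 - b⁻¹)⁻¹ := by rw [e]
    _ = - i31Class a b := by
        rw [h1.inv_left.inv_right.i31Class_one_sub_left, h1.i31Class_inv,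
          h.inv_left.inv_right.i31Class_one_sub, h.i31Class_inv]

theorem i31Class_div_sub_one_left (h : GenericPair a b) :
    i31Class (a / (a - 1)) b = - i31Class a b := by
  have ha := h.ne_zero
  have ha1 : a - 1 ≠ 0 := sub_ne_zero.2 h.ne_one
  have e : a / (a - 1) = (1 - a⁻¹)⁻¹ := by field_simp
  rw [e, h.inv_left.one_sub_left.i31Class_inv_left, h.inv_left.i31Class_one_sub_left,
    h.i31Class_inv_left, neg_neg]

theorem div_sub_one_left (h : GenericPair a b) : GenericPair (a / (a - 1)) b := by
  have ha := h.ne_zero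
  have ha1 : a - 1 ≠ 0 := sub_ne_zero.2 h.ne_one
  have e : a / (a - 1) = (1 - a⁻¹)⁻¹ := by field_simp
  exact e ▸ h.inv_left.one_sub_left.inv_left

theorem genericPair_and_i31Class_of_mem_anhList_left (h : GenericPair a b) {p : ℚ × K2}
    (hp : p ∈ anhList a) :
    GenericPair p.2 b ∧ p.1 • i31Class p.2 b = i31Class a b := by
  simp only [anhList, List.mem_cons, List.not_mem_nil, or_false] at hp
  rcases hp with rfl | rfl | rfl | rfl | rfl | rfl
  · exact ⟨h, one_smul _ _⟩
  · refine ⟨h.one_sub_left.inv_left, ?_⟩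
    rw [one_smul, h.one_sub_left.i31Class_inv_left, h.i31Class_one_sub_left, neg_neg]
  · refine ⟨h.inv_left.one_sub_left, ?_⟩
    rw [one_smul, h.inv_left.i31Class_one_sub_left, h.i31Class_inv_left, neg_neg]
  · refine ⟨h.inv_left, ?_⟩
    rw [h.i31Class_inv_left, neg_smul, one_smul, neg_neg]
  · refine ⟨h.one_sub_left, ?_⟩
    rw [h.i31Class_one_sub_left, neg_smul, one_smul, neg_neg]
  · refine ⟨h.div_sub_one_left, ?_⟩
    rw [h.i31Class_div_sub_one_left, neg_smul, one_smul, neg_neg]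

theorem i31Class_of_mem_anhList_right (h : GenericPair a b) {q : ℚ × K2}
    (hq : q ∈ anhList b) : q.1 • i31Class a q.2 = i31Class a b := by
  obtain ⟨h', hq'⟩ := h.swap.genericPair_and_i31Class_of_mem_anhList_left hq
  rw [h'.i31Class_swap, smul_neg, hq', h.i31Class_swap, neg_neg]

theorem mkQ_Pit_tI31 (h : GenericPair a b) :
    li4Span.mkQ (Pit 4 (tI31 a b)) = i31Class a b := by
  have hsum {p : ℚ × K2} (hp : p ∈ anhList a) :
      ((anhList b).map fun q => (p.1 * q.1) • i31Class p.2 q.2).sum = 6 • i31Class a b := by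
    obtain ⟨h', hp'⟩ := h.genericPair_and_i31Class_of_mem_anhList_left hp
    rw [List.map_congr_left (g := fun _ => i31Class a b), List.map_const', List.sum_replicate]
    · rfl
    · intro q hq
      rw [mul_smul, h'.i31Class_of_mem_anhList_right hq, hp']
  have hsum' : ((anhList a).map fun p =>
      ((anhList b).map fun q => (p.1 * q.1) • i31Class p.2 q.2).sum).sum
        = 6 • 6 • i31Class a b := by
    rw [List.map_congr_left (g := fun _ => 6 • i31Class a b) fun p hp => hsum hp,
      List.map_const', List.sum_replicate]
    rfl
  simp only [i31Class] at hsum' ⊢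
  simp only [tI31, map_smul, map_list_sum, List.map_map, Function.comp_def, hsum']
  module

end GenericPair

/-- The elements of `li4Span` are the finite linear combinations of `Li₄` symbols. -/
theorem exists_eq_sum_of_mem_li4Span {t : TP K2 4} (ht : t ∈ li4Span) :
    ∃ (n : ℕ) (ν : Fin n → ℚ) (g : Fin n → K2),
      (∀ j, g j ∉ Set.range (algebraMap ℚ K2)) ∧ t = ∑ j, ν j • Pit 4 (SLi4 (g j)) := by
  obtain ⟨n, ν, s, rfl⟩ := Submodule.mem_span_set'.1 ht
  choose g hg hgs using fun j => (s j).2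
  exact ⟨n, ν, g, hg, by simp only [hgs]⟩

end Reduction

end GrassPoly

open GrassPoly

/-- Proposition `i31tilde`, first part: `I_{3,1}(x,y) - Ĩ_{3,1}(x,y)` is
(on the level of mod-products symbols) a ℚ-linear combination of `Li₄`'s of nonconstant
rational functions. -/
theorem i31_minus_i31tilde_is_li4 :
    ∃ (n : ℕ) (ν : Fin n → ℚ) (g : Fin n → K2),
      (∀ j, g j ∉ Set.range (algebraMap ℚ K2)) ∧
      Pit 4 (SI31 xx yy) - Pit 4 (tI31 xx yy) = ∑ j, ν j • Pit 4 (SLi4 (g j)) := by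
  refine exists_eq_sum_of_mem_li4Span ?_
  rw [← Submodule.Quotient.mk_eq_zero, ← Submodule.mkQ_apply, map_sub,
    genericPair_xx_yy.mkQ_Pit_tI31]
  exact sub_self _
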